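/- arXiv:1304.4309 — 2 statements merged into one kernel-verified Lean document; each statement's English description precedes it below -/
import Mathlib

section
/- Let f_1 and f_2 be simple set partition statistics, defined by patterns P̲_1, P̲_2 of lengths k_1, k_2 and polynomials Q_1 ∈ ℚ[y_1,…,y_{k_1},m], Q_2 ∈ ℚ[y_1,…,y_{k_2},m]. Then the pointwise product f_1·f_2 is a statistic, i.e. there is a finite ℚ-linear combination g of simple statistics such that g(λ) = f_1(λ)·f_2(λ) for every set partition λ of [n] and every n, and g can be chosen so that every simple statistic appearing in it has degree at most (k_1 + deg Q_1) + (k_2 + deg Q_2). -/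
open Finset

/-- Set partitions of `[n]`, modeled as finpartitions of `Fin n`. -/
abbrev SetPartition (n : ℕ) := Finpartition (Finset.univ : Finset (Fin n))

/-- The `n`-th Bell number: the number of set partitions of `[n]`. -/
def bell (n : ℕ) : ℕ := Fintype.card (SetPartition n)

/-- `i` and `j` lie in the same block of the partition. -/
def SameBlock {n : ℕ} (P : SetPartition n) (i j : Fin n) : Prop :=
  ∃ b ∈ P.parts, i ∈ b ∧ j ∈ b

/-- `i` is the smallest element of its block. -/
def IsFirst {n : ℕ} (P : SetPartition n) (i : Fin n) : Prop :=
  ∀ j, SameBlock P i j → i ≤ j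

/-- `i` is the largest element of its block. -/
def IsLast {n : ℕ} (P : SetPartition n) (i : Fin n) : Prop :=
  ∀ j, SameBlock P i j → j ≤ i

/-- `(i, j)` is an arc: `i < j`, both in the same block, and `j` is the smallest
element of that block greater than `i`. -/
def IsArc {n : ℕ} (P : SetPartition n) (i j : Fin n) : Prop :=
  i < j ∧ SameBlock P i j ∧ ∀ k, i < k → k < j → ¬ SameBlock P i k

/-- The dimension exponent `d(λ) = Σ_blocks (max - min + 1) - n`. -/
def dimExp {n : ℕ} (P : SetPartition n) : ℤ :=
  (∑ b ∈ P.parts.attach,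
      (((b.1.max' (P.nonempty_of_mem_parts b.2)).val : ℤ)
        - ((b.1.min' (P.nonempty_of_mem_parts b.2)).val : ℤ) + 1)) - n

/-- The intertwining exponent (number of 2-crossings): the number of pairs of arcs
`(i₁,j₁), (i₂,j₂)` with `i₁ < i₂ < j₁ < j₂`. -/
noncomputable def inter {n : ℕ} (P : SetPartition n) : ℕ :=
  Set.ncard {q : (Fin n × Fin n) × (Fin n × Fin n) |
    IsArc P q.1.1 q.1.2 ∧ IsArc P q.2.1 q.2.2 ∧
    q.1.1 < q.2.1 ∧ q.2.1 < q.1.2 ∧ q.1.2 < q.2.2}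

/-- A pattern of length `k`: a set partition of `[k]` together with sets of firsts,
lasts, arcs, and consecutive pairs. -/
structure Pattern (k : ℕ) where
  part : SetPartition k
  F : Finset (Fin k)
  L : Finset (Fin k)
  A : Finset (Fin k × Fin k)
  C : Finset (Fin k × Fin k)

/-- `x` is an occurrence of the pattern `pat` in the set partition `P`. -/
def IsOccurrence {n k : ℕ} (pat : Pattern k) (P : SetPartition n) (x : Fin k → Fin n) : Prop :=
  StrictMono x ∧
  (∀ i j, SameBlock P (x i) (x j) ↔ SameBlock pat.part i j) ∧
  (∀ i ∈ pat.F, IsFirst P (x i)) ∧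
  (∀ i ∈ pat.L, IsLast P (x i)) ∧
  (∀ p ∈ pat.A, IsArc P (x p.1) (x p.2)) ∧
  (∀ p ∈ pat.C, |((x p.1).val : ℤ) - ((x p.2).val : ℤ)| = 1)

/-- The simple statistic associated to a pattern `pat` and a polynomial
`Q ∈ ℚ[y₁, …, y_k, m]` (the last variable playing the role of `m = n`):
`f_{P,Q}(λ) = Σ_{s ∈_P λ} Q(x₁, …, x_k, n)`, where elements of `[n] = {1, …, n}`
are identified with values `x.val + 1` for `x : Fin n`. -/
noncomputable def simpleStat {n k : ℕ} (pat : Pattern k) (Q : MvPolynomial (Fin (k + 1)) ℚ)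
    (P : SetPartition n) : ℚ :=
  ∑ᶠ x ∈ {x : Fin k → Fin n | IsOccurrence pat P x},
    MvPolynomial.eval (Fin.snoc (fun i => ((x i).val : ℚ) + 1) (n : ℚ)) Q

theorem sameBlock_iff_mem_part {n : ℕ} (P : SetPartition n) (i j : Fin n) :
    SameBlock P i j ↔ j ∈ P.part i := by
  constructor
  · rintro ⟨b, hb, hi, hj⟩
    rwa [P.part_eq_of_mem hb hi]
  · intro h
    exact ⟨P.part i, P.part_mem.2 (mem_univ i), P.mem_part (mem_univ i), h⟩

theorem sameBlock_iff_part_eq {n : ℕ} (P : SetPartition n) (i j : Fin n) :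
    SameBlock P i j ↔ P.part i = P.part j := by
  rw [sameBlock_iff_mem_part]
  constructor
  · intro h
    exact (P.part_eq_of_mem (P.part_mem.2 (mem_univ i)) h).symm
  · intro h
    rw [h]
    exact P.mem_part (mem_univ j)

theorem setPartition_ext {n : ℕ} {P P' : SetPartition n}
    (h : ∀ i j, SameBlock P i j ↔ SameBlock P' i j) : P = P' := by
  have hpart : ∀ i, P.part i = P'.part i := fun i => by
    ext j
    rw [← sameBlock_iff_mem_part, ← sameBlock_iff_mem_part, h]
  have key : ∀ {R R' : SetPartition n}, (∀ i, R.part i = R'.part i) →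
      ∀ b ∈ R.parts, b ∈ R'.parts := by
    intro R R' hR b hb
    obtain ⟨i, hi⟩ := R.nonempty_of_mem_parts hb
    rw [← R.part_eq_of_mem hb hi, hR]
    exact R'.part_mem.2 (mem_univ i)
  apply Finpartition.ext
  ext b
  exact ⟨key hpart b, key (fun i => (hpart i).symm) b⟩

theorem exists_setPartition_comap {n k : ℕ} (P : SetPartition n) (z : Fin k → Fin n) :
    ∃ R : SetPartition k, ∀ i j, SameBlock R i j ↔ SameBlock P (z i) (z j) := by
  classical
  refine ⟨Finpartition.ofSetoid (Setoid.ker fun i => P.part (z i)), fun i j => ?_⟩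
  rw [sameBlock_iff_mem_part, sameBlock_iff_part_eq, Finpartition.mem_part_ofSetoid_iff_rel]
  exact Setoid.ker_def

/-- A way of overlapping two patterns into a partition of `[k]`: strictly increasing maps from
both index sets, jointly surjective, along which the partition restricts to the given ones. -/
@[ext]
structure PatternMerge {k₁ k₂ : ℕ} (pat₁ : Pattern k₁) (pat₂ : Pattern k₂) (k : ℕ) where
  left : Fin k₁ → Fin k
  right : Fin k₂ → Fin k
  part : SetPartition k
  left_strictMono : StrictMono left
  right_strictMono : StrictMono right
  range_union : Set.range left ∪ Set.range right = Set.univ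
  sameBlock_left : ∀ i j, SameBlock part (left i) (left j) ↔ SameBlock pat₁.part i j
  sameBlock_right : ∀ i j, SameBlock part (right i) (right j) ↔ SameBlock pat₂.part i j

namespace PatternMerge

variable {k₁ k₂ k n : ℕ} {pat₁ : Pattern k₁} {pat₂ : Pattern k₂}

instance : Finite (PatternMerge pat₁ pat₂ k) :=
  Finite.of_injective (fun M => (M.left, M.right, M.part)) fun M M' h => by
    simp only [Prod.mk.injEq] at h
    exact PatternMerge.ext h.1 h.2.1 h.2.2

/-- The pattern carrying the constraints of both merged patterns. -/
def pattern (M : PatternMerge pat₁ pat₂ k) : Pattern k where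
  part := M.part
  F := pat₁.F.image M.left ∪ pat₂.F.image M.right
  L := pat₁.L.image M.left ∪ pat₂.L.image M.right
  A := pat₁.A.image (Prod.map M.left M.left) ∪ pat₂.A.image (Prod.map M.right M.right)
  C := pat₁.C.image (Prod.map M.left M.left) ∪ pat₂.C.image (Prod.map M.right M.right)

theorem isOccurrence_left (M : PatternMerge pat₁ pat₂ k) {P : SetPartition n}
    {z : Fin k → Fin n} (h : IsOccurrence M.pattern P z) :
    IsOccurrence pat₁ P (z ∘ M.left) := by
  obtain ⟨hz, hB, hF, hL, hA, hC⟩ := h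
  refine ⟨hz.comp M.left_strictMono, fun i j => (hB _ _).trans (M.sameBlock_left i j),
    fun i hi => hF _ ?_, fun i hi => hL _ ?_, fun p hp => hA (Prod.map M.left M.left p) ?_,
    fun p hp => hC (Prod.map M.left M.left p) ?_⟩ <;>
  exact mem_union_left _ (mem_image_of_mem _ ‹_›)

theorem isOccurrence_right (M : PatternMerge pat₁ pat₂ k) {P : SetPartition n}
    {z : Fin k → Fin n} (h : IsOccurrence M.pattern P z) :
    IsOccurrence pat₂ P (z ∘ M.right) := by
  obtain ⟨hz, hB, hF, hL, hA, hC⟩ := h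
  refine ⟨hz.comp M.right_strictMono, fun i j => (hB _ _).trans (M.sameBlock_right i j),
    fun i hi => hF _ ?_, fun i hi => hL _ ?_, fun p hp => hA (Prod.map M.right M.right p) ?_,
    fun p hp => hC (Prod.map M.right M.right p) ?_⟩ <;>
  exact mem_union_right _ (mem_image_of_mem _ ‹_›)

theorem isOccurrence_pattern (M : PatternMerge pat₁ pat₂ k) {P : SetPartition n}
    {z : Fin k → Fin n} (hz : StrictMono z)
    (hB : ∀ i j, SameBlock P (z i) (z j) ↔ SameBlock M.part i j)
    (h₁ : IsOccurrence pat₁ P (z ∘ M.left)) (h₂ : IsOccurrence pat₂ P (z ∘ M.right)) :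
    IsOccurrence M.pattern P z := by
  obtain ⟨-, -, hF, hL, hA, hC⟩ := h₁
  obtain ⟨-, -, hF', hL', hA', hC'⟩ := h₂
  refine ⟨hz, hB, fun i hi => ?_, fun i hi => ?_, fun p hp => ?_, fun p hp => ?_⟩ <;>
  simp only [pattern, mem_union, mem_image] at * <;>
  rcases ‹_ ∨ _› with ⟨q, hq, rfl⟩ | ⟨q, hq, rfl⟩
  exacts [hF q hq, hF' q hq, hL q hq, hL' q hq, hA q hq, hA' q hq, hC q hq, hC' q hq]

theorem range_eq (M : PatternMerge pat₁ pat₂ k) (z : Fin k → Fin n) :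
    Set.range z = Set.range (z ∘ M.left) ∪ Set.range (z ∘ M.right) := by
  rw [Set.range_comp, Set.range_comp, ← Set.image_union, M.range_union, Set.image_univ]

/-- Extends a map of pattern positions to polynomial variables, fixing the last variable. -/
def liftVar {k' : ℕ} (e : Fin k' → Fin k) : Fin (k' + 1) → Fin (k + 1) :=
  Fin.snoc (fun i => (e i).castSucc) (Fin.last k)

/-- The product of the two polynomials, in the variables of the merged pattern. -/
noncomputable def poly (M : PatternMerge pat₁ pat₂ k)
    (Q₁ : MvPolynomial (Fin (k₁ + 1)) ℚ) (Q₂ : MvPolynomial (Fin (k₂ + 1)) ℚ) :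
    MvPolynomial (Fin (k + 1)) ℚ :=
  MvPolynomial.rename (liftVar M.left) Q₁ * MvPolynomial.rename (liftVar M.right) Q₂

theorem totalDegree_poly_le (M : PatternMerge pat₁ pat₂ k)
    (Q₁ : MvPolynomial (Fin (k₁ + 1)) ℚ) (Q₂ : MvPolynomial (Fin (k₂ + 1)) ℚ) :
    (M.poly Q₁ Q₂).totalDegree ≤ Q₁.totalDegree + Q₂.totalDegree :=
  (MvPolynomial.totalDegree_mul _ _).trans
    (add_le_add (MvPolynomial.totalDegree_rename_le _ _) (MvPolynomial.totalDegree_rename_le _ _))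

theorem snoc_comp_liftVar {k' : ℕ} (e : Fin k' → Fin k) (v : Fin k → ℚ) (a : ℚ) :
    (Fin.snoc v a : Fin (k + 1) → ℚ) ∘ liftVar e = Fin.snoc (fun i => v (e i)) a := by
  funext i
  refine Fin.lastCases ?_ (fun i => ?_) i <;> simp [liftVar]

theorem eval_poly (M : PatternMerge pat₁ pat₂ k)
    (Q₁ : MvPolynomial (Fin (k₁ + 1)) ℚ) (Q₂ : MvPolynomial (Fin (k₂ + 1)) ℚ)
    (v : Fin k → ℚ) (a : ℚ) :
    MvPolynomial.eval (Fin.snoc v a) (M.poly Q₁ Q₂) =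
      MvPolynomial.eval (Fin.snoc (fun i => v (M.left i)) a) Q₁ *
        MvPolynomial.eval (Fin.snoc (fun i => v (M.right i)) a) Q₂ := by
  rw [poly, map_mul, MvPolynomial.eval_rename, MvPolynomial.eval_rename, snoc_comp_liftVar,
    snoc_comp_liftVar]

/-- Restricts an occurrence of a merged pattern to occurrences of the two patterns. -/
def restrict (pat₁ : Pattern k₁) (pat₂ : Pattern k₂) (P : SetPartition n)
    (s : Σ t : (Σ k : Fin (k₁ + k₂ + 1), PatternMerge pat₁ pat₂ k),
      {z : Fin t.1 → Fin n // IsOccurrence t.2.pattern P z}) :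
    {x : Fin k₁ → Fin n // IsOccurrence pat₁ P x} ×
      {y : Fin k₂ → Fin n // IsOccurrence pat₂ P y} :=
  (⟨s.2.1 ∘ s.1.2.left, s.1.2.isOccurrence_left s.2.2⟩,
    ⟨s.2.1 ∘ s.1.2.right, s.1.2.isOccurrence_right s.2.2⟩)

theorem restrict_injective (P : SetPartition n) :
    Function.Injective (restrict pat₁ pat₂ P) := by
  rintro ⟨⟨⟨k, hk⟩, M⟩, z, hz⟩ ⟨⟨⟨k', hk'⟩, M'⟩, z', hz'⟩ h
  simp only [restrict, Prod.mk.injEq, Subtype.mk.injEq] at h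
  obtain ⟨hl, hr⟩ := h
  dsimp only at M M' z z' hz hz' hl hr
  have hrange : Set.range z = Set.range z' := by
    rw [M.range_eq z, M'.range_eq z', hl, hr]
  have hcard : k = k' := by
    have := congrArg Set.ncard hrange
    rwa [← Set.image_univ, ← Set.image_univ, Set.ncard_image_of_injective _ hz.1.injective,
      Set.ncard_image_of_injective _ hz'.1.injective, Set.ncard_univ, Set.ncard_univ,
      Nat.card_fin, Nat.card_fin] at this
  subst hcard
  obtain rfl : z = z' := (StrictMono.range_inj hz.1 hz'.1).1 hrange
  obtain rfl : M = M' :=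
    PatternMerge.ext (hz.1.injective.comp_left hl) (hz.1.injective.comp_left hr)
      (setPartition_ext fun i j => (hz.2.1 i j).symm.trans (hz'.2.1 i j))
  rfl

theorem restrict_surjective (P : SetPartition n) :
    Function.Surjective (restrict pat₁ pat₂ P) := by
  rintro ⟨⟨x, hx⟩, ⟨y, hy⟩⟩
  set S : Finset (Fin n) := univ.image x ∪ univ.image y with hS
  have hcard : S.card ≤ k₁ + k₂ := by
    refine (card_union_le _ _).trans (add_le_add ?_ ?_) <;>
    exact card_image_le.trans (card_fin _).le
  let z : Fin S.card → Fin n := fun c => S.orderEmbOfFin rfl c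
  have hzm : StrictMono z := (S.orderEmbOfFin rfl).strictMono
  have hzr : Set.range z = S := S.range_orderEmbOfFin rfl
  have hxz : ∀ i, ∃ c, z c = x i := fun i => by
    change x i ∈ Set.range z
    simp [hzr, hS]
  have hyz : ∀ i, ∃ c, z c = y i := fun i => by
    change y i ∈ Set.range z
    simp [hzr, hS]
  choose l hl using hxz
  choose r hr using hyz
  obtain ⟨R, hR⟩ := exists_setPartition_comap P z
  have hlx : z ∘ l = x := funext hl
  have hry : z ∘ r = y := funext hr
  let M : PatternMerge pat₁ pat₂ S.card :=
    { left := l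
      right := r
      part := R
      left_strictMono := fun i j hij => hzm.lt_iff_lt.1 (by rw [hl, hl]; exact hx.1 hij)
      right_strictMono := fun i j hij => hzm.lt_iff_lt.1 (by rw [hr, hr]; exact hy.1 hij)
      range_union := by
        apply hzm.injective.image_injective
        rw [Set.image_union, ← Set.range_comp, ← Set.range_comp, hlx, hry, Set.image_univ, hzr, hS]
        simp
      sameBlock_left := fun i j => by rw [hR, hl, hl]; exact hx.2.1 i j
      sameBlock_right := fun i j => by rw [hR, hr, hr]; exact hy.2.1 i j }
  refine ⟨⟨⟨⟨S.card, Nat.lt_succ_of_le hcard⟩, M⟩, z,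
    M.isOccurrence_pattern hzm (fun i j => (hR i j).symm) (hlx.symm ▸ hx) (hry.symm ▸ hy)⟩, ?_⟩
  simp only [restrict, Prod.mk.injEq, Subtype.mk.injEq]
  exact ⟨hlx, hry⟩

end PatternMerge

open Classical in
theorem simpleStat_eq_sum_subtype {n k : ℕ} (pat : Pattern k)
    (Q : MvPolynomial (Fin (k + 1)) ℚ) (P : SetPartition n) :
    simpleStat pat Q P = ∑ x : {x : Fin k → Fin n // IsOccurrence pat P x},
      MvPolynomial.eval (Fin.snoc (fun i => ((x.1 i).val : ℚ) + 1) (n : ℚ)) Q := by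
  rw [simpleStat, ← finsum_set_coe_eq_finsum_mem]
  exact finsum_eq_sum_of_fintype _

open Classical in
theorem simpleStat_mul_simpleStat {n k₁ k₂ : ℕ} (pat₁ : Pattern k₁) (pat₂ : Pattern k₂)
    (Q₁ : MvPolynomial (Fin (k₁ + 1)) ℚ) (Q₂ : MvPolynomial (Fin (k₂ + 1)) ℚ)
    (P : SetPartition n) [Fintype (Σ k : Fin (k₁ + k₂ + 1), PatternMerge pat₁ pat₂ k)] :
    simpleStat pat₁ Q₁ P * simpleStat pat₂ Q₂ P =
      ∑ t : (Σ k : Fin (k₁ + k₂ + 1), PatternMerge pat₁ pat₂ k),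
        simpleStat t.2.pattern (t.2.poly Q₁ Q₂) P := by
  simp only [simpleStat_eq_sum_subtype]
  rw [Fintype.sum_mul_sum, ← Fintype.sum_prod_type', ← Fintype.sum_sigma']
  symm
  refine Fintype.sum_bijective (PatternMerge.restrict pat₁ pat₂ P)
    ⟨PatternMerge.restrict_injective P, PatternMerge.restrict_surjective P⟩ _ _ fun s => ?_
  exact PatternMerge.eval_poly _ _ _ _ _

/-- The pointwise product of two simple statistics is a statistic: a finite
`ℚ`-linear combination of simple statistics, each of degree at most the sum of the
degrees of the two factors. -/
theorem product_of_simpleStats_isStatistic (k₁ k₂ : ℕ) (pat₁ : Pattern k₁) (pat₂ : Pattern k₂)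
    (Q₁ : MvPolynomial (Fin (k₁ + 1)) ℚ) (Q₂ : MvPolynomial (Fin (k₂ + 1)) ℚ) :
    ∃ (m : ℕ) (len : Fin m → ℕ) (pats : ∀ t, Pattern (len t))
      (Qs : ∀ t, MvPolynomial (Fin (len t + 1)) ℚ) (c : Fin m → ℚ),
      (∀ t, len t + (Qs t).totalDegree ≤
        (k₁ + Q₁.totalDegree) + (k₂ + Q₂.totalDegree)) ∧
      ∀ (n : ℕ) (P : SetPartition n),
        simpleStat pat₁ Q₁ P * simpleStat pat₂ Q₂ P =
          ∑ t, c t * simpleStat (pats t) (Qs t) P := by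
  have := Fintype.ofFinite (Σ k : Fin (k₁ + k₂ + 1), PatternMerge pat₁ pat₂ k)
  let e := Fintype.equivFin (Σ k : Fin (k₁ + k₂ + 1), PatternMerge pat₁ pat₂ k)
  refine ⟨_, fun t => (e.symm t).1, fun t => (e.symm t).2.pattern,
    fun t => (e.symm t).2.poly Q₁ Q₂, fun _ => 1, fun t => ?_, fun n P => ?_⟩
  · have hk := (e.symm t).1.is_le
    have hQ := (e.symm t).2.totalDegree_poly_le Q₁ Q₂
    dsimp only
    omega
  · simp only [one_mul]
    rw [simpleStat_mul_simpleStat]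
    exact (e.symm.sum_comp fun t => simpleStat t.2.pattern (t.2.poly Q₁ Q₂) P).symm
end

section
/- For each integer k ≥ 0 there exist polynomials P_{k,0}, P_{k,1}, …, P_{k,2k} with rational coefficients such that for all n ≥ 1, Σ_{λ ∈ Π(n)} d(λ)^k = Σ_{j=0}^{2k} P_{k,j}(n)·B_{n+j}; moreover, for 0 ≤ j ≤ 2k, the degree of P_{k,2k−j} is at most j when j ≤ k, and at most k − ⌈(j−k)/2⌉ when j > k. -/
open Finset

namespace Finpartition

variable {α : Type*} [DecidableEq α]

/-- Add `a` to the part `b` of a finpartition, or as a singleton part when `b = ∅`. -/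
def insertElem {s : Finset α} (P : Finpartition s) {a : α} (ha : a ∉ s) {b : Finset α}
    (hb : b ∈ insert ∅ P.parts) : Finpartition (insert a s) :=
  ofExistsUnique (insert (insert a b) (P.parts.erase b))
    (by
      have h := fun p (hp : p ∈ P.parts) => P.subset hp
      grind)
    (by
      have hsub := fun p (hp : p ∈ P.parts) => P.subset hp
      intro x hx
      obtain rfl | hxa := eq_or_ne x a
      · exact ⟨insert x b, by simp, by grind⟩
      · obtain ⟨t, ⟨ht, hxt⟩, huniq⟩ := P.existsUnique_mem (a := x) (by grind)
        by_cases htb : t = b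
        · refine ⟨insert a b, by grind, ?_⟩
          rintro u ⟨hu, hxu⟩
          have := huniq u
          grind
        · refine ⟨t, by grind, ?_⟩
          rintro u ⟨hu, hxu⟩
          have := huniq u
          have := huniq b
          grind)
    (by
      have := P.empty_notMem_parts
      grind [Finset.insert_ne_empty])

/-- Remove `a` from the ground set of a finpartition. -/
def removeElem {s : Finset α} {a : α} (ha : a ∉ s) (P : Finpartition (insert a s)) :
    Finpartition s :=
  ofExistsUnique ((insert ((P.part a).erase a) (P.parts.erase (P.part a))).erase ∅)
    (by
      have hsub := fun p (hp : p ∈ P.parts) => P.subset hp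
      have h1 : P.part a ∈ P.parts := by simp
      have h2 : a ∈ P.part a := by simp
      have h3 := fun p (hp : p ∈ P.parts) (h : a ∈ p) => P.eq_of_mem_parts hp h1 h h2
      grind)
    (by
      have hsub := fun p (hp : p ∈ P.parts) => P.subset hp
      have h1 : P.part a ∈ P.parts := by simp
      have h2 : a ∈ P.part a := by simp
      intro x hx
      obtain ⟨t, ⟨ht, hxt⟩, huniq⟩ := P.existsUnique_mem (a := x) (by grind)
      by_cases htb : t = P.part a
      · refine ⟨(P.part a).erase a, by grind, ?_⟩
        rintro u ⟨hu, hxu⟩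
        have := huniq u
        grind
      · refine ⟨t, by grind, ?_⟩
        rintro u ⟨hu, hxu⟩
        have := huniq u
        have := huniq (P.part a)
        grind)
    (by simp)

theorem sum_parts_insert {s : Finset α} {a : α} (ha : a ∉ s) {M : Type*} [AddCommMonoid M]
    (F : Finset (Finset α) → M) :
    ∑ P : Finpartition (insert a s), F P.parts =
      ∑ P : Finpartition s,
        (F (insert {a} P.parts) + ∑ b ∈ P.parts, F (insert (insert a b) (P.parts.erase b))) := by
  have key : ∀ P : Finpartition s,
      F (insert {a} P.parts) + ∑ b ∈ P.parts, F (insert (insert a b) (P.parts.erase b)) =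
        ∑ b : {b // b ∈ insert ∅ P.parts}, F (P.insertElem ha b.2).parts := by
    intro P
    have := Finset.sum_attach (insert ∅ P.parts)
      (fun b => F (insert (insert a b) (P.parts.erase b)))
    simp only [insertElem, ofExistsUnique_parts]
    rw [Finset.univ_eq_attach, this, Finset.sum_insert P.empty_notMem_parts,
      Finset.erase_eq_of_notMem P.empty_notMem_parts]
    rfl
  simp_rw [key]
  rw [← Fintype.sum_sigma'
    (fun (P : Finpartition s) (b : {b // b ∈ insert ∅ P.parts}) => F (P.insertElem ha b.2).parts)]
  symm
  apply Finset.sum_bij (fun x _ => x.1.insertElem ha x.2.2) (by simp) _ _ (by simp)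
  · rintro ⟨P, b, hb⟩ - ⟨Q, c, hc⟩ - h
    have hP := fun p (hp : p ∈ P.parts) => P.subset hp
    have hQ := fun p (hp : p ∈ Q.parts) => Q.subset hp
    have hP0 := P.empty_notMem_parts
    have hQ0 := Q.empty_notMem_parts
    have h' : insert (insert a b) (P.parts.erase b) = insert (insert a c) (Q.parts.erase c) :=
      congrArg Finpartition.parts h
    have hab : a ∉ b := by grind
    have hac : a ∉ c := by grind
    have hbc : insert a b = insert a c := by
      have : insert a b ∈ insert (insert a c) (Q.parts.erase c) := by rw [← h']; simp
      grind
    obtain rfl : b = c := by rw [← erase_insert hab, hbc, erase_insert hac]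
    have h1 : P.parts.erase b = Q.parts.erase b := by
      have e1 : insert a b ∉ P.parts.erase b := by grind
      have e2 : insert a b ∉ Q.parts.erase b := by grind
      rw [← erase_insert e1, h', erase_insert e2]
    have h2 : P.parts = Q.parts := by
      obtain rfl | hb0 := eq_or_ne b ∅
      · rwa [erase_eq_of_notMem hP0, erase_eq_of_notMem hQ0] at h1
      · rw [← insert_erase (mem_of_mem_insert_of_ne hb hb0), h1,
          insert_erase (mem_of_mem_insert_of_ne hc hb0)]
    obtain rfl : P = Q := Finpartition.ext h2
    rfl
  · intro P _
    have hsub := fun p (hp : p ∈ P.parts) => P.subset hp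
    have h1 : P.part a ∈ P.parts := by simp
    have h2 : a ∈ P.part a := by simp
    have h0 := P.empty_notMem_parts
    refine ⟨⟨P.removeElem ha, (P.part a).erase a, ?_⟩, by simp, ?_⟩
    · simp only [removeElem, ofExistsUnique_parts]; grind
    · apply Finpartition.ext
      simp only [insertElem, removeElem, ofExistsUnique_parts]
      rw [insert_erase h2]
      have : (P.part a).erase a ∉ P.parts.erase (P.part a) := by
        intro h
        obtain ⟨x, hx⟩ := P.nonempty_of_mem_parts (mem_of_mem_erase h)
        have := P.eq_of_mem_parts (mem_of_mem_erase h) h1 hx (mem_of_mem_erase hx)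
        grind
      ext t
      have : a ∉ t → t ≠ P.part a := by grind
      grind

end Finpartition
section OpenBlocks

variable {α : Type*} [DecidableEq α]

/-- The dimension exponent of a family `X` of blocks on a ground set of size `m`, where the blocks
in `S` are still open and hence count as extending up to the end of the ground set. A closed block
`b` extends from `lo b` to `hi b`. -/
def openDim (lo hi : Finset α → ℤ) (m : ℤ) (X S : Finset (Finset α)) : ℤ :=
  ∑ b ∈ X, ((if b ∈ S then m else hi b) - lo b) - m

theorem sum_open_succ (lo hi : Finset α → ℤ) (m : ℤ) {Y S T U : Finset (Finset α)} (hU : U ⊆ Y)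
    (hS : ∀ p ∈ Y, p ∈ S ↔ p ∈ U) (hT : ∀ p ∈ Y, p ∈ T ↔ p ∈ U) :
    ∑ b ∈ Y, ((if b ∈ T then m + 1 else hi b) - lo b) =
      ∑ b ∈ Y, ((if b ∈ S then m else hi b) - lo b) + #U := by
  have hc : ((#U : ℕ) : ℤ) = ∑ b ∈ Y, if b ∈ U then 1 else 0 := by
    rw [Finset.sum_boole, Finset.filter_mem_eq_inter, Finset.inter_eq_right.2 hU]
  rw [hc, ← Finset.sum_add_distrib]
  refine Finset.sum_congr rfl fun b hb => ?_
  rw [if_congr (hS b hb) rfl rfl, if_congr (hT b hb) rfl rfl]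
  split_ifs <;> ring

variable {lo hi : Finset α → ℤ} {m : ℤ} {a : α} {X : Finset (Finset α)}
  {R : Type*} [CommRing R]

theorem sum_powerset_insert_singleton (haX : {a} ∉ X) (hhi : hi {a} = m + 1) (hlo : lo {a} = m)
    (G : ℤ → ℕ → R) :
    ∑ T ∈ (insert {a} X).powerset, G (openDim lo hi (m + 1) (insert {a} X) T) #T =
      ∑ S ∈ X.powerset, (G (openDim lo hi m X S + #S) #S +
        G (openDim lo hi m X S + #S) (#S + 1)) := by
  rw [Finset.sum_powerset_insert haX, ← Finset.sum_add_distrib]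
  refine Finset.sum_congr rfl fun S hS => ?_
  rw [Finset.mem_powerset] at hS
  have haS : {a} ∉ S := fun h => haX (hS h)
  have h1 : openDim lo hi (m + 1) (insert {a} X) S = openDim lo hi m X S + #S := by
    rw [openDim, Finset.sum_insert haX, if_neg haS,
      sum_open_succ lo hi m (S := S) hS (by simp) (by simp), openDim, hhi, hlo]
    ring
  have h2 : openDim lo hi (m + 1) (insert {a} X) (insert {a} S) = openDim lo hi m X S + #S := by
    rw [openDim, Finset.sum_insert haX, if_pos (Finset.mem_insert_self _ _),
      sum_open_succ lo hi m (S := S) hS (by simp) (by grind), openDim, hlo]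
    ring
  rw [h1, h2, Finset.card_insert_of_notMem haS]

theorem sum_sum_powerset_insert_erase (haX : ∀ b ∈ X, a ∉ b)
    (hhi : ∀ b ∈ X, hi (insert a b) = m + 1) (hlo : ∀ b ∈ X, lo (insert a b) = lo b)
    (G : ℤ → ℕ → R) :
    ∑ b ∈ X, ∑ T ∈ (insert (insert a b) (X.erase b)).powerset,
        G (openDim lo hi (m + 1) (insert (insert a b) (X.erase b)) T) #T =
      ∑ S ∈ X.powerset, #S * (G (openDim lo hi m X S + #S - 1) #S +
        G (openDim lo hi m X S + #S - 1) (#S - 1)) := by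
  have key : ∀ b ∈ X, ∑ T ∈ (insert (insert a b) (X.erase b)).powerset,
        G (openDim lo hi (m + 1) (insert (insert a b) (X.erase b)) T) #T =
      ∑ U ∈ (X.erase b).powerset, (G (openDim lo hi m X (insert b U) + #U) (#U + 1) +
        G (openDim lo hi m X (insert b U) + #U) #U) := by
    intro b hb
    have hab : insert a b ∉ X.erase b := by grind
    rw [Finset.sum_powerset_insert hab, add_comm, ← Finset.sum_add_distrib]
    refine Finset.sum_congr rfl fun U hU => ?_
    rw [Finset.mem_powerset] at hU
    have habU : insert a b ∉ U := fun h => hab (hU h)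
    have h0 : openDim lo hi m X (insert b U) =
        (m - lo b) + ∑ p ∈ X.erase b, ((if p ∈ insert b U then m else hi p) - lo p) - m := by
      rw [openDim, ← Finset.add_sum_erase X _ hb, if_pos (Finset.mem_insert_self _ _)]
    have h1 : openDim lo hi (m + 1) (insert (insert a b) (X.erase b)) (insert (insert a b) U) =
        openDim lo hi m X (insert b U) + #U := by
      rw [h0, openDim, Finset.sum_insert hab, if_pos (Finset.mem_insert_self _ _),
        sum_open_succ lo hi m (S := insert b U) hU (by grind) (by grind), hlo b hb]
      ring
    have h2 : openDim lo hi (m + 1) (insert (insert a b) (X.erase b)) U =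
        openDim lo hi m X (insert b U) + #U := by
      rw [h0, openDim, Finset.sum_insert hab, if_neg habU,
        sum_open_succ lo hi m (S := insert b U) hU (by grind) (by grind), hlo b hb, hhi b hb]
      ring
    rw [h1, h2, Finset.card_insert_of_notMem habU]
  have swap : ∀ S ∈ X.powerset, #S * (G (openDim lo hi m X S + #S - 1) #S +
        G (openDim lo hi m X S + #S - 1) (#S - 1)) =
      ∑ _b ∈ S, (G (openDim lo hi m X S + #S - 1) #S +
        G (openDim lo hi m X S + #S - 1) (#S - 1)) := by
    intro S _
    rw [Finset.sum_const, nsmul_eq_mul]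
  rw [Finset.sum_congr rfl key, Finset.sum_congr rfl swap, Finset.sum_sigma', Finset.sum_sigma']
  refine Finset.sum_bij' (fun x _ => ⟨insert x.1 x.2, x.1⟩) (fun x _ => ⟨x.2, x.1.erase x.2⟩)
    ?_ ?_ ?_ ?_ ?_
  · rintro ⟨b, U⟩ h
    simp only [Finset.mem_sigma, Finset.mem_powerset] at h ⊢
    grind
  · rintro ⟨S, b⟩ h
    simp only [Finset.mem_sigma, Finset.mem_powerset] at h ⊢
    grind
  · rintro ⟨b, U⟩ h
    simp only [Finset.mem_sigma, Finset.mem_powerset] at h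
    have : b ∉ U := by grind
    simp [Finset.erase_insert this]
  · rintro ⟨S, b⟩ h
    simp only [Finset.mem_sigma, Finset.mem_powerset] at h
    simp [Finset.insert_erase h.2]
  · rintro ⟨b, U⟩ h
    simp only [Finset.mem_sigma, Finset.mem_powerset] at h
    have : b ∉ U := by grind
    simp [Finset.card_insert_of_notMem this, ← add_assoc]

/-- One step of the transfer recursion: the ground set grows by its new last element `a`. -/
theorem sum_openDim_insert {s : Finset α} (ha : a ∉ s)
    (hhi : ∀ b ⊆ s, hi (insert a b) = m + 1) (hlo₀ : lo {a} = m)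
    (hlo : ∀ b ⊆ s, b.Nonempty → lo (insert a b) = lo b) (G : ℤ → ℕ → R) :
    ∑ P : Finpartition (insert a s), ∑ T ∈ P.parts.powerset,
        G (openDim lo hi (m + 1) P.parts T) #T =
      ∑ P : Finpartition s, ∑ S ∈ P.parts.powerset,
        ((G (openDim lo hi m P.parts S + #S) #S + G (openDim lo hi m P.parts S + #S) (#S + 1)) +
          #S * (G (openDim lo hi m P.parts S + #S - 1) #S +
            G (openDim lo hi m P.parts S + #S - 1) (#S - 1))) := by
  rw [Finpartition.sum_parts_insert ha
    (fun X => ∑ T ∈ X.powerset, G (openDim lo hi (m + 1) X T) #T)]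
  refine Finset.sum_congr rfl fun P _ => ?_
  have hs := fun p (hp : p ∈ P.parts) => P.subset hp
  rw [sum_powerset_insert_singleton (by grind) (hhi ∅ (by simp)) hlo₀,
    sum_sum_powerset_insert_erase (by grind) (fun b hb => hhi b (hs b hb))
      (fun b hb => hlo b (hs b hb) (P.nonempty_of_mem_parts hb)), ← Finset.sum_add_distrib]

end OpenBlocks
section Moments

theorem add_pow_div_factorial (x y : ℚ) (k : ℕ) :
    (x + y) ^ k / k.factorial =
      ∑ ij ∈ antidiagonal k, x ^ ij.1 / ij.1.factorial * (y ^ ij.2 / ij.2.factorial) := by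
  rw [(Commute.all x y).add_pow' k, Finset.sum_div]
  refine Finset.sum_congr rfl fun ij hij => ?_
  rw [HasAntidiagonal.mem_antidiagonal] at hij
  have h := Nat.add_choose_mul_factorial_mul_factorial ij.1 ij.2
  rw [hij, ← Nat.choose_symm_of_eq_add hij.symm] at h
  have h' : ((k.choose ij.1 : ℚ)) * ij.1.factorial * ij.2.factorial = k.factorial := mod_cast h
  have h1 := Nat.factorial_ne_zero ij.1
  have h2 := Nat.factorial_ne_zero ij.2
  have h3 := Nat.factorial_ne_zero k
  rw [nsmul_eq_mul]
  field_simp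
  linear_combination (x ^ ij.1 * y ^ ij.2) * h'

variable {N : ℕ}

/-- The value of the least element of a block (`0` for the empty block). -/
def blockLo (b : Finset (Fin N)) : ℤ := if h : b.Nonempty then ((b.min' h).val : ℤ) else 0

/-- One more than the value of the largest element of a block (`0` for the empty block). -/
def blockHi (b : Finset (Fin N)) : ℤ := if h : b.Nonempty then ((b.max' h).val : ℤ) + 1 else 0

/-- The initial segment of `Fin N` of length `m`. -/
abbrev initSeg (N m : ℕ) : Finset (Fin N) := univ.filter fun i => i.val < m

/-- The `k`-th divided-power moment of `openDim` over all partitions of the initial segment of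
length `m` with some open blocks, weighted by a function of the number of open blocks. -/
noncomputable def openMoment (N m k : ℕ) (h : ℕ → ℚ) : ℚ :=
  ∑ P : Finpartition (initSeg N m), ∑ S ∈ P.parts.powerset,
    (openDim blockLo blockHi m P.parts S : ℚ) ^ k / k.factorial * h #S

/-- The action of one transfer step, with exponent `j`, on functions of the number of open
blocks. -/
def stepFun (j : ℕ) (h : ℕ → ℚ) (a : ℕ) : ℚ :=
  ((a : ℚ) ^ j * (h a + h (a + 1)) + a * ((a : ℚ) - 1) ^ j * (h a + h (a - 1))) / j.factorial

theorem openMoment_zero (k : ℕ) (h : ℕ → ℚ) :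
    openMoment N 0 k h = if k = 0 then h 0 else 0 := by
  have h0 : initSeg N 0 = ⊥ := by simp [initSeg]
  rw [openMoment, h0, Fintype.sum_unique]
  simp only [Finpartition.default_eq_empty, Finpartition.empty_parts, Finset.powerset_empty,
    Finset.sum_singleton, openDim, Finset.sum_empty]
  by_cases hk : k = 0 <;> simp [hk]

theorem openMoment_succ {m : ℕ} (hm : m < N) (k : ℕ) (h : ℕ → ℚ) :
    openMoment N (m + 1) k h =
      ∑ ij ∈ antidiagonal k, openMoment N m ij.1 (stepFun ij.2 h) := by
  have hins : initSeg N (m + 1) = insert ⟨m, hm⟩ (initSeg N m) := by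
    ext i; simp [Fin.ext_iff]; omega
  have ha : (⟨m, hm⟩ : Fin N) ∉ initSeg N m := by simp
  have hlt : ∀ b ⊆ initSeg N m, ∀ i ∈ b, i < ⟨m, hm⟩ := fun b hb i hi => by
    simpa [Fin.lt_def] using hb hi
  have hhi : ∀ b ⊆ initSeg N m, blockHi (insert ⟨m, hm⟩ b) = (m : ℤ) + 1 := by
    intro b hb
    rw [blockHi, dif_pos (Finset.insert_nonempty _ _)]
    have : (insert ⟨m, hm⟩ b).max' (Finset.insert_nonempty _ _) = ⟨m, hm⟩ := by
      refine le_antisymm (Finset.max'_le _ _ _ fun i hi => ?_) (Finset.le_max' _ _ (by simp))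
      obtain rfl | hi := Finset.mem_insert.1 hi
      · exact le_rfl
      · exact (hlt b hb i hi).le
    rw [this]
  have hlo₀ : blockLo {(⟨m, hm⟩ : Fin N)} = m := by simp [blockLo]
  have hlo : ∀ b ⊆ initSeg N m, b.Nonempty → blockLo (insert ⟨m, hm⟩ b) = blockLo b := by
    intro b hb hne
    rw [blockLo, dif_pos (Finset.insert_nonempty _ _), blockLo, dif_pos hne]
    have : (insert ⟨m, hm⟩ b).min' (Finset.insert_nonempty _ _) = b.min' hne := by
      refine le_antisymm (Finset.min'_le _ _ (by simp [Finset.min'_mem])) ?_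
      refine Finset.le_min' _ _ _ fun i hi => ?_
      obtain rfl | hi := Finset.mem_insert.1 hi
      · exact (hlt b hb _ (Finset.min'_mem _ _)).le
      · exact Finset.min'_le _ _ hi
    rw [this]
  have key := sum_openDim_insert (lo := blockLo) (hi := blockHi) (m := (m : ℤ)) ha hhi hlo₀ hlo
    (fun d a => (d : ℚ) ^ k / k.factorial * h a)
  simp only [openMoment]
  rw [hins, Nat.cast_succ, key, Finset.sum_comm]
  refine Finset.sum_congr rfl fun P _ => ?_
  rw [Finset.sum_comm]
  refine Finset.sum_congr rfl fun S _ => ?_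
  set d : ℚ := (openDim blockLo blockHi m P.parts S : ℚ) with hd
  have e1 : ((openDim blockLo blockHi m P.parts S + #S : ℤ) : ℚ) = d + (#S : ℚ) := by
    push_cast; rfl
  have e2 : ((openDim blockLo blockHi m P.parts S + #S - 1 : ℤ) : ℚ) = d + ((#S : ℚ) - 1) := by
    push_cast; ring
  rw [e1, e2, add_pow_div_factorial, add_pow_div_factorial, Finset.sum_mul, Finset.sum_mul,
    Finset.sum_mul, Finset.sum_mul, ← Finset.sum_add_distrib, ← Finset.sum_add_distrib,
    Finset.mul_sum, ← Finset.sum_add_distrib]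
  refine Finset.sum_congr rfl fun ij _ => ?_
  simp only [stepFun]
  ring

theorem sum_dimExp_pow (n k : ℕ) :
    ∑ lam : SetPartition n, (dimExp lam : ℚ) ^ k =
      k.factorial * openMoment n n k (fun a => if a = 0 then 1 else 0) := by
  have hseg : initSeg n n = univ := by simp [initSeg]
  have hk : (k.factorial : ℚ) ≠ 0 := mod_cast Nat.factorial_ne_zero k
  rw [openMoment, hseg, Finset.mul_sum]
  refine Finset.sum_congr rfl fun P _ => ?_
  rw [Finset.sum_eq_single ∅]
  · have : openDim blockLo blockHi n P.parts ∅ = dimExp P := by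
      rw [openDim, dimExp, ← Finset.sum_attach P.parts]
      congr 1
      refine Finset.sum_congr rfl fun b _ => ?_
      have hb := P.nonempty_of_mem_parts b.2
      simp only [Finset.notMem_empty, if_false, blockHi, blockLo, dif_pos hb]
      ring
    rw [this]
    simp
    field_simp
  · intro S _ hS
    simp [hS]
  · simp

end Moments
section Operators

open Polynomial

/-- The umbral functional sending `X ^ n` to the `n`-th Bell number. -/
noncomputable def bellFunctional : ℚ[X] →ₗ[ℚ] ℚ :=
  Polynomial.lsum fun i => (Nat.bell i : ℚ) • LinearMap.id

theorem bellFunctional_X_pow (n : ℕ) : bellFunctional (X ^ n) = Nat.bell n := by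
  rw [bellFunctional, Polynomial.lsum_apply, ← Polynomial.monomial_one_right_eq_X_pow,
    Polynomial.sum_monomial_index] <;> simp

theorem bellFunctional_X_mul (p : ℚ[X]) :
    bellFunctional (X * p) = bellFunctional (taylor 1 p) := by
  induction p using Polynomial.induction_on' with
  | add p q hp hq => simp only [mul_add, map_add, hp, hq]
  | monomial n c =>
    rw [← Polynomial.C_mul_X_pow_eq_monomial, ← Polynomial.smul_eq_C_mul, mul_smul_comm, map_smul,
      map_smul, map_smul, ← pow_succ', bellFunctional_X_pow, Polynomial.taylor_X_pow, map_one,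
      (Commute.all (X : ℚ[X]) 1).add_pow', map_sum, Nat.bell_succ', Nat.cast_sum,
      ← Finset.Nat.sum_antidiagonal_swap]
    congr 1
    refine Finset.sum_congr rfl fun ij hij => ?_
    rw [Finset.HasAntidiagonal.mem_antidiagonal] at hij
    rw [one_pow, mul_one, map_nsmul, bellFunctional_X_pow, nsmul_eq_mul, Nat.cast_mul]
    simp [Nat.choose_symm_of_eq_add hij.symm]

/-- The lowering operator `f(x) ↦ f(x + 1)`. -/
noncomputable def lower : Module.End ℚ ℚ[X] := taylor 1

/-- The raising operator `f(x) ↦ x f(x - 1)`. -/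
noncomputable def raise : Module.End ℚ ℚ[X] :=
  LinearMap.mulLeft ℚ X * taylor (-1)

theorem lower_apply (f : ℚ[X]) : lower f = taylor 1 f := rfl

theorem raise_apply (f : ℚ[X]) : raise f = X * taylor (-1) f := rfl

theorem raise_lower (f : ℚ[X]) : raise (lower f) = X * f := by
  simp [raise_apply, lower_apply, Polynomial.taylor_taylor]

theorem lower_mul_raise : lower * raise = raise * lower + 1 := by
  refine LinearMap.ext fun f => ?_
  simp [raise_apply, lower_apply, Polynomial.taylor_taylor, Polynomial.taylor_mul]
  ring

theorem bellFunctional_raise (f : ℚ[X]) : bellFunctional (raise f) = bellFunctional f := by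
  rw [raise_apply, bellFunctional_X_mul, Polynomial.taylor_taylor]
  simp

/-- The counting operator of the open blocks. -/
noncomputable def countOp : Module.End ℚ ℚ[X] := (raise - 1) * (lower - 1)

/-- The sequence of umbral finite differences at the origin. -/
noncomputable def diffSeq (f : ℚ[X]) (a : ℕ) : ℚ := bellFunctional (((lower - 1) ^ a) f)

theorem sub_one_pow_mul_raise (a : ℕ) :
    (lower - 1) ^ a * raise = raise * (lower - 1) ^ a + a • (lower - 1) ^ (a - 1) := by
  induction a with
  | zero => simp
  | succ a ih =>
    have hc : (lower - 1) * raise = raise * (lower - 1) + 1 := by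
      rw [sub_mul, lower_mul_raise, mul_sub]; simp only [one_mul, mul_one]; abel
    rw [pow_succ', mul_assoc, ih, mul_add, ← mul_assoc, hc, add_mul, one_mul, mul_smul_comm,
      mul_assoc]
    rcases a with _ | a
    · simp
    · simp only [Nat.add_sub_cancel, ← pow_succ']
      simp only [add_smul, one_smul]
      abel

theorem diffSeq_raise (f : ℚ[X]) (a : ℕ) :
    diffSeq (raise f) a = diffSeq f a + a * diffSeq f (a - 1) := by
  have := congrArg (fun φ : Module.End ℚ ℚ[X] => bellFunctional (φ f)) (sub_one_pow_mul_raise a)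
  simp only [Module.End.mul_apply, LinearMap.add_apply, LinearMap.smul_apply, map_add, map_nsmul,
    bellFunctional_raise] at this
  rwa [nsmul_eq_mul] at this

theorem diffSeq_lower_sub_one (f : ℚ[X]) (a : ℕ) :
    diffSeq ((lower - 1) f) a = diffSeq f (a + 1) := by
  rw [diffSeq, diffSeq, pow_succ, Module.End.mul_apply]

theorem diffSeq_sub (f g : ℚ[X]) (a : ℕ) : diffSeq (f - g) a = diffSeq f a - diffSeq g a := by
  simp [diffSeq]

theorem diffSeq_lower (f : ℚ[X]) (a : ℕ) :
    diffSeq (lower f) a = diffSeq f a + diffSeq f (a + 1) := by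
  rw [← diffSeq_lower_sub_one, LinearMap.sub_apply, diffSeq_sub]
  simp

theorem diffSeq_countOp_pow (j : ℕ) (f : ℚ[X]) (a : ℕ) :
    diffSeq ((countOp ^ j) f) a = (a : ℚ) ^ j * diffSeq f a := by
  induction j with
  | zero => simp
  | succ j ih =>
    rw [pow_succ', Module.End.mul_apply, countOp, Module.End.mul_apply, ← countOp,
      LinearMap.sub_apply, diffSeq_sub, diffSeq_raise, Module.End.one_apply]
    rcases a with _ | a
    · simp
    · rw [Nat.add_sub_cancel, diffSeq_lower_sub_one, diffSeq_lower_sub_one, ih]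
      ring

/-- The coefficient of order `j` of one transfer step, acting on polynomials. -/
noncomputable def stepOp (j : ℕ) : Module.End ℚ ℚ[X] :=
  (1 / (j.factorial : ℚ)) • (raise * countOp ^ j * lower)

theorem diffSeq_stepOp (j : ℕ) (f : ℚ[X]) :
    diffSeq (stepOp j f) = stepFun j (diffSeq f) := by
  funext a
  have hs : ∀ (c : ℚ) (g : ℚ[X]), diffSeq (c • g) a = c * diffSeq g a := by
    intro c g; simp [diffSeq]
  rw [stepOp, LinearMap.smul_apply, hs, Module.End.mul_apply, Module.End.mul_apply,
    diffSeq_raise, diffSeq_countOp_pow, diffSeq_countOp_pow, diffSeq_lower, diffSeq_lower, stepFun]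
  rcases a with _ | a
  · simp; ring
  · rw [Nat.add_sub_cancel]
    push_cast
    ring

/-- The generating series of the step operators. -/
noncomputable def stepSeries : PowerSeries (Module.End ℚ ℚ[X]) := PowerSeries.mk stepOp

theorem openMoment_diffSeq {N m : ℕ} (hm : m ≤ N) (k : ℕ) (f : ℚ[X]) :
    openMoment N m k (diffSeq f) =
      bellFunctional (PowerSeries.coeff k (stepSeries ^ m) f) := by
  induction m generalizing k f with
  | zero =>
    rw [openMoment_zero, pow_zero, PowerSeries.coeff_one]
    split_ifs <;> simp [diffSeq]
  | succ m ih =>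
    rw [openMoment_succ (by omega), pow_succ, PowerSeries.coeff_mul, LinearMap.sum_apply, map_sum]
    refine Finset.sum_congr rfl fun ij _ => ?_
    rw [← diffSeq_stepOp, ih (by omega), Module.End.mul_apply, stepSeries, PowerSeries.coeff_mk]

theorem diffSeq_one : diffSeq 1 = fun a => if a = 0 then 1 else 0 := by
  funext a
  rcases a with _ | a
  · have := bellFunctional_X_pow 0
    simp_all [diffSeq]
  · simp [diffSeq, pow_succ, lower_apply]

/-- The polynomials whose umbral values are the divided-power moments of `dimExp`. -/
noncomputable def momentPoly (k n : ℕ) : ℚ[X] := PowerSeries.coeff k (stepSeries ^ n) 1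

theorem sum_dimExp_pow_eq_bellFunctional (n k : ℕ) :
    ∑ lam : SetPartition n, (dimExp lam : ℚ) ^ k =
      k.factorial * bellFunctional (momentPoly k n) := by
  rw [sum_dimExp_pow, ← diffSeq_one, openMoment_diffSeq le_rfl, momentPoly]

/-- The counting operator conjugated by the lowering operator. -/
noncomputable def conjCountOp : Module.End ℚ ℚ[X] :=
  LinearMap.mulLeft ℚ X - LinearMap.mulLeft ℚ (X - 1) * taylor (-1) - taylor 1

theorem conjCountOp_apply (f : ℚ[X]) :
    conjCountOp f = X * f - (X - 1) * taylor (-1) f - taylor 1 f := rfl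

theorem lower_mul_conjCountOp : SemiconjBy lower conjCountOp countOp := by
  refine LinearMap.ext fun f => ?_
  simp [raise_apply, lower_apply, countOp, conjCountOp_apply, Polynomial.taylor_taylor,
    Polynomial.taylor_mul]
  ring

theorem stepOp_apply (j : ℕ) (f : ℚ[X]) :
    stepOp j f = (1 / (j.factorial : ℚ)) • (X * (conjCountOp ^ j) f) := by
  rw [stepOp, LinearMap.smul_apply, mul_assoc, ← (lower_mul_conjCountOp.pow_right j).eq,
    Module.End.mul_apply, Module.End.mul_apply, raise_lower]

theorem momentPoly_zero (k : ℕ) : momentPoly k 0 = if k = 0 then 1 else 0 := by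
  rw [momentPoly, pow_zero, PowerSeries.coeff_one]
  split_ifs <;> simp

theorem momentPoly_succ (k n : ℕ) :
    momentPoly k (n + 1) = X * (momentPoly k n + ∑ j ∈ Finset.range k,
      (1 / ((j + 1).factorial : ℚ)) • (conjCountOp ^ (j + 1)) (momentPoly (k - (j + 1)) n)) := by
  rw [momentPoly, pow_succ', PowerSeries.coeff_mul, LinearMap.sum_apply,
    Finset.Nat.sum_antidiagonal_eq_sum_range_succ_mk, Finset.sum_range_succ', mul_add, add_comm,
    Finset.mul_sum]
  simp only [Module.End.mul_apply, stepSeries, PowerSeries.coeff_mk, stepOp_apply]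
  simp [momentPoly, stepSeries]

theorem momentPoly_zero_left (n : ℕ) : momentPoly 0 n = X ^ n := by
  induction n with
  | zero => simp [momentPoly_zero]
  | succ n ih => rw [momentPoly_succ, ih]; simp [pow_succ']

theorem bell_eq (n : ℕ) : bell n = Nat.bell n := by
  have h := sum_dimExp_pow_eq_bellFunctional n 0
  rw [momentPoly_zero_left, bellFunctional_X_pow] at h
  simp only [pow_zero, Finset.sum_const, nsmul_eq_mul, mul_one, Finset.card_univ,
    Nat.factorial_zero, Nat.cast_one, one_mul] at h
  exact_mod_cast h

end Operators
section ExponentialPolynomials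

open Polynomial

/-- The factor carried by terms with base `X + t` once the step operators have been applied. -/
noncomputable def lowFactor (t : ℤ) : ℚ[X] := taylor (-1) (descPochhammer ℚ (-t).toNat)

/-- The factor carried by terms with base `X + t` in the moment polynomials. -/
noncomputable def outFactor (t : ℤ) : ℚ[X] := if t = 0 then 1 else X * lowFactor t

/-- Constraints on a term `n ^ a * p * (X + t) ^ n`. -/
structure IsTerm (E : ℤ → ℚ[X]) (w₀ w₁ : ℤ) (m a : ℕ) (t : ℤ) (p : ℚ[X]) : Prop where
  order : ∃ i : ℕ, (X + C (t : ℚ)) ^ i ∣ p ∧ (2 * a : ℤ) ≤ (if t = 0 then w₀ else w₁) + i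
  degree : a + p.natDegree + t.toNat ≤ m
  factor : E t ∣ p

/-- The exponential polynomial `n ^ a * p * (X + t) ^ n`. -/
noncomputable def expTerm (a : ℕ) (t : ℤ) (p : ℚ[X]) (n : ℕ) : ℚ[X] :=
  (n : ℚ[X]) ^ a * p * (X + C (t : ℚ)) ^ n

/-- The span of the terms satisfying given constraints. -/
noncomputable def expSpan (E : ℤ → ℚ[X]) (w₀ w₁ : ℤ) (m : ℕ) : Submodule ℚ (ℕ → ℚ[X]) :=
  Submodule.span ℚ {f | ∃ a t p, IsTerm E w₀ w₁ m a t p ∧ f = expTerm a t p}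

variable {E : ℤ → ℚ[X]} {w₀ w₁ v₀ v₁ : ℤ} {m m' a : ℕ} {t : ℤ} {p : ℚ[X]}

theorem IsTerm.mem (h : IsTerm E w₀ w₁ m a t p) : expTerm a t p ∈ expSpan E w₀ w₁ m :=
  Submodule.subset_span ⟨a, t, p, h, rfl⟩

theorem expSpan_mono {E' : ℤ → ℚ[X]} (hE : ∀ t, E' t ∣ E t) (h₀ : w₀ ≤ v₀) (h₁ : w₁ ≤ v₁)
    (hm : m ≤ m') : expSpan E w₀ w₁ m ≤ expSpan E' v₀ v₁ m' := by
  refine Submodule.span_mono ?_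
  rintro f ⟨a, t, p, ⟨⟨i, hi, hw⟩, hd, hf⟩, rfl⟩
  refine ⟨a, t, p, ⟨⟨i, hi, ?_⟩, by omega, (hE t).trans hf⟩, rfl⟩
  split_ifs at hw ⊢ <;> omega

theorem lowFactor_dvd_outFactor (t : ℤ) : lowFactor t ∣ outFactor t := by
  rw [outFactor]
  split_ifs with h
  · simp [lowFactor, h]
  · exact dvd_mul_left _ _

theorem taylor_dvd_taylor {p q : ℚ[X]} (r : ℚ) (h : p ∣ q) : taylor r p ∣ taylor r q := by
  obtain ⟨c, rfl⟩ := h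
  rw [taylor_mul]
  exact dvd_mul_right _ _

theorem taylor_neg_one_eq_comp (p : ℚ[X]) : taylor (-1) p = p.comp (X - 1) := by
  rw [taylor_apply, map_neg, map_one, sub_eq_add_neg]

theorem descPochhammer_succ_eq (n : ℕ) :
    descPochhammer ℚ (n + 1) = X * taylor (-1) (descPochhammer ℚ n) := by
  rw [descPochhammer_succ_left, taylor_neg_one_eq_comp]

theorem lowFactor_sub_one_dvd (t : ℤ) :
    lowFactor (t - 1) ∣ (X - 1) * taylor (-1) (lowFactor t) := by
  rcases le_or_gt t 0 with h | h
  · have : (-(t - 1)).toNat = (-t).toNat + 1 := by omega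
    rw [lowFactor, this, descPochhammer_succ_eq, taylor_mul, taylor_X, lowFactor, map_neg, map_one,
      ← sub_eq_add_neg]
  · have : (-(t - 1)).toNat = 0 := by omega
    rw [lowFactor, this]
    simp

theorem lowFactor_add_one_dvd (t : ℤ) : lowFactor (t + 1) ∣ taylor 1 (lowFactor t) := by
  rcases lt_or_ge t 0 with h | h
  · have : (-t).toNat = (-(t + 1)).toNat + 1 := by omega
    rw [lowFactor.eq_1 t, taylor_taylor, this, descPochhammer_succ_eq, lowFactor]
    simp
  · have : (-(t + 1)).toNat = 0 := by omega
    rw [lowFactor.eq_1 (t + 1), this]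
    simp

theorem taylor_X_add_C_pow (r s : ℚ) (n : ℕ) : taylor r ((X + C s) ^ n) = (X + C (s + r)) ^ n := by
  rw [taylor_pow, map_add, taylor_X, taylor_C, map_add]
  ring

theorem taylor_natCast (r : ℚ) (n : ℕ) : taylor r (n : ℚ[X]) = n := by
  rw [← map_natCast C, taylor_C]

theorem taylor_expTerm (r : ℤ) (n : ℕ) :
    taylor (r : ℚ) (expTerm a t p n) = expTerm a (t + r) (taylor (r : ℚ) p) n := by
  rw [expTerm, expTerm, taylor_mul, taylor_mul, taylor_pow, taylor_natCast, taylor_X_add_C_pow]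
  push_cast
  rfl

theorem isTerm_shift (r : ℤ) (h : IsTerm E w₀ w₁ m a t p) {q : ℚ[X]} {E' : ℤ → ℚ[X]} {m' : ℕ}
    (hq : taylor (r : ℚ) p ∣ q) (hd : a + q.natDegree + (t + r).toNat ≤ m')
    (hE : E' (t + r) ∣ q)
    (hw : (if t = 0 then w₀ else w₁) ≤ if t + r = 0 then v₀ else v₁) :
    IsTerm E' v₀ v₁ m' a (t + r) q := by
  obtain ⟨⟨i, hi, hiw⟩, -, -⟩ := h
  refine ⟨⟨i, ?_, by omega⟩, hd, hE⟩
  have := taylor_dvd_taylor (r : ℚ) hi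
  rw [taylor_X_add_C_pow, ← Int.cast_add] at this
  exact this.trans hq

theorem conjCountOp_mem (h₀ : w₀ - 1 ≤ v₀) (h₁ : w₁ ≤ v₀) (h₂ : w₀ ≤ v₁) (h₃ : w₁ ≤ v₁)
    {U : ℕ → ℚ[X]} (hU : U ∈ expSpan lowFactor w₀ w₁ m) :
    (fun n => conjCountOp (U n)) ∈ expSpan lowFactor v₀ v₁ (m + 1) := by
  suffices h : expSpan lowFactor w₀ w₁ m ≤
      (expSpan lowFactor v₀ v₁ (m + 1)).comap (conjCountOp.compLeft ℕ) from h hU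
  refine Submodule.span_le.2 ?_
  rintro f ⟨a, t, p, h, rfl⟩
  have hX : IsTerm lowFactor v₀ v₁ (m + 1) a t (X * p) := by
    obtain ⟨⟨i, hi, hw⟩, hd, hf⟩ := h
    have hdeg : (X * p).natDegree ≤ 1 + p.natDegree :=
      natDegree_mul_le.trans (by simp)
    refine ⟨?_, by omega, hf.mul_left _⟩
    by_cases ht : t = 0
    · subst ht
      refine ⟨i + 1, ?_, ?_⟩
      · rw [pow_succ']
        exact mul_dvd_mul (by simp) hi
      · simp only [if_true] at hw ⊢
        push_cast
        omega
    · refine ⟨i, hi.mul_left _, ?_⟩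
      rw [if_neg ht] at hw ⊢
      omega
  have hdn : IsTerm lowFactor v₀ v₁ (m + 1) a (t + (-1 : ℤ))
      ((X - 1) * taylor ((-1 : ℤ) : ℚ) p) := by
    refine isTerm_shift (-1) h (dvd_mul_left _ _) ?_ ?_ ?_
    · have hdeg : ((X - 1) * taylor ((-1 : ℤ) : ℚ) p).natDegree ≤ 1 + p.natDegree := by
        refine natDegree_mul_le.trans ?_
        rw [natDegree_taylor]
        gcongr
        exact (natDegree_X_sub_C (1 : ℚ)).le
      have := h.degree
      omega
    · rw [← sub_eq_add_neg]
      refine (lowFactor_sub_one_dvd t).trans (mul_dvd_mul_left _ ?_)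
      push_cast
      exact taylor_dvd_taylor _ h.factor
    · split_ifs <;> omega
  have hup : IsTerm lowFactor v₀ v₁ (m + 1) a (t + (1 : ℤ)) (taylor ((1 : ℤ) : ℚ) p) := by
    refine isTerm_shift 1 h dvd_rfl ?_ ?_ ?_
    · have := h.degree
      rw [natDegree_taylor]
      omega
    · refine (lowFactor_add_one_dvd t).trans ?_
      push_cast
      exact taylor_dvd_taylor _ h.factor
    · split_ifs <;> omega
  have key : (conjCountOp.compLeft ℕ) (expTerm a t p) =
      expTerm a t (X * p) - expTerm a (t + (-1 : ℤ)) ((X - 1) * taylor ((-1 : ℤ) : ℚ) p) -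
        expTerm a (t + (1 : ℤ)) (taylor ((1 : ℤ) : ℚ) p) := by
    funext n
    have e1 := taylor_expTerm (a := a) (t := t) (p := p) (-1) n
    have e2 := taylor_expTerm (a := a) (t := t) (p := p) 1 n
    simp only [LinearMap.compLeft_apply, Function.comp_apply, conjCountOp_apply, Pi.sub_apply]
    rw [← e2]
    have e3 : expTerm a (t + (-1 : ℤ)) ((X - 1) * taylor ((-1 : ℤ) : ℚ) p) n =
        (X - 1) * taylor ((-1 : ℤ) : ℚ) (expTerm a t p n) := by
      rw [e1]; simp only [expTerm]; ring
    rw [e3]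
    push_cast
    simp only [expTerm]
    ring
  rw [SetLike.mem_coe, Submodule.mem_comap, key]
  exact Submodule.sub_mem _ (Submodule.sub_mem _ hX.mem hdn.mem) hup.mem

theorem conjCountOp_pow_mem {κ : ℤ} {m j : ℕ} {U : ℕ → ℚ[X]}
    (hU : U ∈ expSpan lowFactor κ (κ - 1) m) :
    (fun n => (conjCountOp ^ (j + 1)) (U n)) ∈
      expSpan lowFactor (κ + j - 1) (κ + j) (m + j + 1) := by
  have h : ∀ j : ℕ, (fun n => (conjCountOp ^ (j + 2)) (U n)) ∈
      expSpan lowFactor κ κ (m + j + 2) := by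
    intro j
    induction j with
    | zero =>
      have h1 := conjCountOp_mem (v₀ := κ - 1) (v₁ := κ) (by omega) (by omega) (by omega) (by omega)
        hU
      have h2 := conjCountOp_mem (v₀ := κ) (v₁ := κ) (by omega) (by omega) (by omega) (by omega) h1
      simpa [pow_succ'] using h2
    | succ j ih =>
      have := conjCountOp_mem (v₀ := κ) (v₁ := κ) (by omega) (by omega) (by omega) (by omega) ih
      rw [show m + (j + 1) + 2 = m + j + 2 + 1 by omega]
      simpa only [show j + 1 + 2 = j + 2 + 1 from rfl, pow_succ' _ (j + 2),
        Module.End.mul_apply] using this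
  rcases j with _ | j
  · have h1 := conjCountOp_mem (v₀ := κ - 1) (v₁ := κ) (by omega) (by omega) (by omega) (by omega)
      hU
    simpa using h1
  · exact expSpan_mono (fun _ => dvd_rfl) (by push_cast; omega) (by push_cast; omega) (by omega)
      (h j)

/-- The solution operator of the recurrence `F (n + 1) = X * (F n + U n)` with `F 0 = 0`. -/
noncomputable def geomConv : Module.End ℚ (ℕ → ℚ[X]) where
  toFun U n := ∑ g ∈ Finset.range n, X ^ (n - g) * U g
  map_add' U V := by
    funext n
    simp [mul_add, Finset.sum_add_distrib]
  map_smul' c U := by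
    funext n
    simp [Finset.smul_sum]

theorem geomConv_apply (U : ℕ → ℚ[X]) (n : ℕ) :
    geomConv U n = ∑ g ∈ Finset.range n, X ^ (n - g) * U g := rfl

theorem geomConv_zero (U : ℕ → ℚ[X]) : geomConv U 0 = 0 := by
  simp [geomConv_apply]

theorem geomConv_succ (U : ℕ → ℚ[X]) (n : ℕ) :
    geomConv U (n + 1) = X * (geomConv U n + U n) := by
  rw [geomConv_apply, geomConv_apply, Finset.sum_range_succ, mul_add, Finset.mul_sum]
  congr 1
  · refine Finset.sum_congr rfl fun g hg => ?_
    rw [Finset.mem_range] at hg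
    rw [Nat.sub_add_comm hg.le, pow_succ']
    ring
  · simp

theorem geomConv_expTerm_zero (a : ℕ) (p : ℚ[X]) :
    geomConv (expTerm a 0 p) = ∑ i ∈ Finset.range (a + 1),
      (_root_.bernoulli i * ((a + 1).choose i) / (a + 1) : ℚ) • expTerm (a + 1 - i) 0 p := by
  funext n
  have h : geomConv (expTerm a 0 p) n =
      C (∑ g ∈ Finset.range n, (g : ℚ) ^ a) * (p * X ^ n) := by
    rw [geomConv_apply, map_sum, Finset.sum_mul]
    refine Finset.sum_congr rfl fun g hg => ?_
    rw [Finset.mem_range] at hg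
    obtain ⟨d, rfl⟩ := Nat.exists_eq_add_of_lt hg
    rw [expTerm, show g + d + 1 - g = d + 1 by omega]
    simp only [Int.cast_zero, map_zero, add_zero, map_pow, map_natCast]
    ring
  rw [h, sum_range_pow, map_sum, Finset.sum_mul, Finset.sum_apply]
  refine Finset.sum_congr rfl fun i _ => ?_
  rw [Pi.smul_apply, smul_eq_C_mul, expTerm,
    show (_root_.bernoulli i * ((a + 1).choose i) * (n : ℚ) ^ (a + 1 - i) / (a + 1) : ℚ) =
      (_root_.bernoulli i * ((a + 1).choose i) / (a + 1)) * (n : ℚ) ^ (a + 1 - i) by ring, map_mul]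
  simp only [Int.cast_zero, map_zero, add_zero, map_pow, map_natCast]
  ring

theorem smul_geomConv_expTerm (a : ℕ) (t : ℤ) (p : ℚ[X]) :
    (t : ℚ) • geomConv (expTerm a t p) =
      expTerm a t (X * p) - (0 : ℚ) ^ a • expTerm 0 0 (X * p) -
        ∑ b ∈ Finset.range a, (a.choose b : ℚ) • geomConv (expTerm b t (p * (X + C (t : ℚ)))) := by
  funext n
  simp only [Pi.smul_apply, Pi.sub_apply, Finset.sum_apply, smul_eq_C_mul]
  induction n with
  | zero => simp [geomConv_zero, expTerm]
  | succ n ih =>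
    have hsum : ∑ b ∈ Finset.range a, C (a.choose b : ℚ) *
          geomConv (expTerm b t (p * (X + C (t : ℚ)))) (n + 1) =
        X * ∑ b ∈ Finset.range a, C (a.choose b : ℚ) *
          geomConv (expTerm b t (p * (X + C (t : ℚ)))) n +
        X * p * (X + C (t : ℚ)) ^ (n + 1) *
          (((n : ℚ[X]) + 1) ^ a - (n : ℚ[X]) ^ a) := by
      rw [add_pow (n : ℚ[X]) 1 a, Finset.sum_range_succ, Nat.choose_self, Nat.cast_one, tsub_self,
        pow_zero,
        mul_one, mul_one, add_sub_cancel_right, Finset.mul_sum, Finset.mul_sum,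
        ← Finset.sum_add_distrib]
      refine Finset.sum_congr rfl fun b _ => ?_
      rw [geomConv_succ, expTerm.eq_1 b, one_pow, map_natCast]
      ring
    rw [hsum, geomConv_succ]
    have h0 : expTerm 0 0 (X * p) (n + 1) = X * expTerm 0 0 (X * p) n := by
      simp only [expTerm, Int.cast_zero, map_zero, add_zero]
      ring
    rw [h0, mul_left_comm, mul_add, ih]
    simp only [expTerm]
    push_cast
    ring

theorem geomConv_mem (h : 0 ≤ v₀) (h₀ : w₀ + 2 ≤ v₀) (h₁ : w₁ ≤ v₁) {U : ℕ → ℚ[X]}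
    (hU : U ∈ expSpan lowFactor w₀ w₁ m) : geomConv U ∈ expSpan outFactor v₀ v₁ (m + 1) := by
  suffices hle : expSpan lowFactor w₀ w₁ m ≤
      (expSpan outFactor v₀ v₁ (m + 1)).comap geomConv from hle hU
  refine Submodule.span_le.2 ?_
  rintro f ⟨a, t, p, hT, rfl⟩
  rw [SetLike.mem_coe, Submodule.mem_comap]
  by_cases ht : t = 0
  · subst ht
    rw [geomConv_expTerm_zero]
    refine Submodule.sum_mem _ fun i _ => Submodule.smul_mem _ _ (IsTerm.mem ?_)
    obtain ⟨⟨i, hi, hw⟩, hd, -⟩ := hT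
    refine ⟨⟨i, hi, ?_⟩, by omega, by simp [outFactor]⟩
    simp only [if_true] at hw ⊢
    omega
  · have ht' : (t : ℚ) ≠ 0 := by exact_mod_cast ht
    induction a using Nat.strong_induction_on generalizing p with
    | _ a ih =>
    rw [← Submodule.smul_mem_iff _ ht', smul_geomConv_expTerm]
    obtain ⟨⟨i, hi, hw⟩, hd, hf⟩ := hT
    rw [if_neg ht] at hw
    have hdeg : (X * p).natDegree ≤ 1 + p.natDegree := natDegree_mul_le.trans (by simp)
    refine Submodule.sub_mem _ (Submodule.sub_mem _ (IsTerm.mem ?_)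
      (Submodule.smul_mem _ _ (IsTerm.mem ?_))) (Submodule.sum_mem _ fun b hb =>
        Submodule.smul_mem _ _ (ih b (Finset.mem_range.1 hb) _ ?_))
    · refine ⟨⟨i, hi.mul_left _, ?_⟩, by omega, ?_⟩
      · rw [if_neg ht]
        omega
      · rw [outFactor, if_neg ht]
        exact mul_dvd_mul_left _ hf
    · refine ⟨⟨0, by simp, by simpa using h⟩, ?_, by simp [outFactor]⟩
      simp only [Int.toNat_zero]
      omega
    · rw [Finset.mem_range] at hb
      have hdeg' : (p * (X + C (t : ℚ))).natDegree ≤ p.natDegree + 1 :=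
        natDegree_mul_le.trans (by rw [natDegree_X_add_C])
      refine ⟨⟨i, hi.mul_right _, ?_⟩, by omega, hf.mul_right _⟩
      rw [if_neg ht]
      omega

theorem momentPoly_mem (k : ℕ) : momentPoly k ∈ expSpan outFactor k (k - 1) (2 * k) := by
  induction k using Nat.strong_induction_on with
  | _ k ih =>
  rcases Nat.eq_zero_or_pos k with rfl | hk
  · have : momentPoly 0 = expTerm 0 0 1 := by
      funext n
      simp [momentPoly_zero_left, expTerm]
    rw [this]
    exact IsTerm.mem ⟨⟨0, by simp, by simp⟩, by simp, by simp [outFactor]⟩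
  · have key : momentPoly k = geomConv (fun n => ∑ j ∈ Finset.range k,
        (1 / ((j + 1).factorial : ℚ)) • (conjCountOp ^ (j + 1)) (momentPoly (k - (j + 1)) n)) := by
      funext n
      induction n with
      | zero => rw [geomConv_zero, momentPoly_zero, if_neg hk.ne']
      | succ n hn => rw [momentPoly_succ, geomConv_succ, hn]
    rw [key]
    have hm : 2 * k = 2 * k - 1 + 1 := by omega
    rw [hm]
    refine geomConv_mem (w₀ := (k : ℤ) - 2) (w₁ := (k : ℤ) - 1) (by omega) (by omega) le_rfl ?_
    have hfun : (fun n => ∑ j ∈ Finset.range k, (1 / ((j + 1).factorial : ℚ)) •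
          (conjCountOp ^ (j + 1)) (momentPoly (k - (j + 1)) n)) =
        ∑ j ∈ Finset.range k, (1 / ((j + 1).factorial : ℚ)) •
          fun n => (conjCountOp ^ (j + 1)) (momentPoly (k - (j + 1)) n) := by
      funext n
      simp [Finset.sum_apply]
    rw [hfun]
    refine Submodule.sum_mem _ fun j hj => Submodule.smul_mem _ _ ?_
    rw [Finset.mem_range] at hj
    have h1 := expSpan_mono lowFactor_dvd_outFactor le_rfl le_rfl le_rfl
      (ih (k - (j + 1)) (by omega))
    exact expSpan_mono (fun _ => dvd_rfl) (by omega) (by omega) (by omega)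
      (conjCountOp_pow_mem (j := j) h1)

theorem bellFunctional_descPochhammer_mul (s : ℕ) (f : ℚ[X]) :
    bellFunctional (descPochhammer ℚ s * taylor (-s : ℚ) f) = bellFunctional f := by
  induction s with
  | zero => simp
  | succ s ih =>
    rw [← ih, ← bellFunctional_raise (descPochhammer ℚ s * _), raise_apply, taylor_mul,
      taylor_taylor, descPochhammer_succ_eq, mul_assoc]
    push_cast
    rw [neg_add_rev]

theorem dvd_of_pow_dvd_descPochhammer_mul {s i : ℕ} {q : ℚ[X]}
    (h : (X + C (-s : ℚ)) ^ i ∣ descPochhammer ℚ s * q) : (X + C (-s : ℚ)) ^ i ∣ q := by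
  rw [map_neg, ← sub_eq_add_neg] at h ⊢
  refine (prime_X_sub_C (s : ℚ)).pow_dvd_of_dvd_mul_left i ?_ h
  rw [dvd_iff_isRoot, IsRoot, descPochhammer_eval_eq_descFactorial, Nat.descFactorial_self]
  exact_mod_cast s.factorial_ne_zero

theorem IsTerm.exists_bellFunctional_eq (h : IsTerm outFactor w₀ (w₀ - 1) m a t p) :
    ∃ (r : ℚ[X]) (i : ℕ), X ^ i ∣ r ∧ (2 * a : ℤ) ≤ w₀ + i ∧ a + r.natDegree ≤ m ∧
      ∀ n, bellFunctional (expTerm a t p n) = (n : ℚ) ^ a * bellFunctional (r * X ^ n) := by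
  obtain ⟨⟨i, hi, hw⟩, hd, hf⟩ := h
  have hw' : (2 * a : ℤ) ≤ w₀ + i := by split_ifs at hw <;> omega
  have hscal : ∀ (n : ℕ) (f : ℚ[X]),
      bellFunctional ((n : ℚ[X]) ^ a * f) = (n : ℚ) ^ a * bellFunctional f := by
    intro n f
    rw [← smul_eq_mul ((n : ℚ) ^ a), ← map_smul, smul_eq_C_mul, map_pow, map_natCast]
  rcases le_or_gt 0 t with ht | ht
  · obtain ⟨s, rfl⟩ := Int.eq_ofNat_of_zero_le ht
    refine ⟨descPochhammer ℚ s * taylor (-s : ℚ) p, i, ?_, hw', ?_, fun n => ?_⟩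
    · have := taylor_dvd_taylor (-s : ℚ) hi
      rw [taylor_X_add_C_pow] at this
      simp only [Int.cast_natCast, add_neg_cancel, map_zero, add_zero] at this
      exact this.mul_left _
    · have : (descPochhammer ℚ s * taylor (-s : ℚ) p).natDegree ≤ s + p.natDegree := by
        refine natDegree_mul_le.trans ?_
        rw [natDegree_taylor, descPochhammer_natDegree]
      simp only [Int.toNat_natCast] at hd
      omega
    · rw [expTerm, mul_assoc, hscal, ← bellFunctional_descPochhammer_mul s, taylor_mul,
        taylor_X_add_C_pow]
      simp [mul_assoc]
  · obtain ⟨s, hs⟩ := Int.eq_ofNat_of_zero_le (show 0 ≤ -t by omega)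
    obtain rfl : t = -(s : ℤ) := by omega
    have hp : descPochhammer ℚ s ∣ p := by
      rw [outFactor, if_neg ht.ne, lowFactor, ← descPochhammer_succ_eq, neg_neg, Int.toNat_natCast,
        descPochhammer_succ_right] at hf
      exact (dvd_mul_right _ _).trans hf
    obtain ⟨q, rfl⟩ := hp
    simp only [Int.cast_neg, Int.cast_natCast] at hi
    refine ⟨taylor (s : ℚ) q, i, ?_, hw', ?_, fun n => ?_⟩
    · have := taylor_dvd_taylor (s : ℚ) (dvd_of_pow_dvd_descPochhammer_mul hi)
      rw [taylor_X_add_C_pow] at this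
      simpa using this
    · rw [natDegree_taylor]
      rcases eq_or_ne q 0 with rfl | hq
      · simp only [natDegree_zero]
        omega
      · rw [(monic_descPochhammer ℚ s).natDegree_mul' hq] at hd
        omega
    · rw [expTerm, mul_assoc, hscal, ← bellFunctional_descPochhammer_mul s (taylor _ _ * _),
        taylor_mul, taylor_taylor, taylor_pow, taylor_X]
      simp [mul_assoc]

theorem bellFunctional_mul_X_pow {r : ℚ[X]} {M : ℕ} (hr : r.natDegree < M) (n : ℕ) :
    bellFunctional (r * X ^ n) = ∑ j ∈ Finset.range M, r.coeff j * Nat.bell (n + j) := by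
  conv_lhs => rw [r.as_sum_range_C_mul_X_pow' hr]
  rw [Finset.sum_mul, map_sum]
  refine Finset.sum_congr rfl fun j _ => ?_
  rw [mul_assoc, ← pow_add, ← smul_eq_C_mul, map_smul, bellFunctional_X_pow, add_comm, smul_eq_mul]

theorem exists_bell_coeff_of_mem (k : ℕ) {f : ℕ → ℚ[X]}
    (hf : f ∈ expSpan outFactor k (k - 1) (2 * k)) :
    ∃ P : ℕ → ℚ[X],
      (∀ n, bellFunctional (f n) =
        ∑ j ∈ Finset.range (2 * k + 1), (P j).eval (n : ℚ) * Nat.bell (n + j)) ∧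
      ∀ j ≤ 2 * k, 2 * (P j).natDegree ≤ k + j ∧ (P j).natDegree + j ≤ 2 * k := by
  induction hf using Submodule.span_induction with
  | mem f hf =>
    obtain ⟨a, t, p, h, rfl⟩ := hf
    obtain ⟨r, i, hi, hw, hd, hr⟩ := h.exists_bellFunctional_eq
    refine ⟨fun j => C (r.coeff j) * X ^ a, fun n => ?_, fun j hj => ?_⟩
    · rw [hr, bellFunctional_mul_X_pow (show r.natDegree < 2 * k + 1 by omega), Finset.mul_sum]
      refine Finset.sum_congr rfl fun j _ => ?_
      simp only [eval_mul, eval_C, eval_pow, eval_X]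
      ring
    · rcases eq_or_ne (r.coeff j) 0 with h0 | h0
      · simp only [h0, map_zero, zero_mul, natDegree_zero]
        omega
      · have hij : i ≤ j := by
          by_contra hij
          exact h0 (X_pow_dvd_iff.1 hi j (by omega))
        have hjr := le_natDegree_of_ne_zero h0
        have := natDegree_C_mul_X_pow_le (r.coeff j) a
        dsimp only
        omega
  | zero => exact ⟨0, by simp, by simp⟩
  | add f g _ _ ihf ihg =>
    obtain ⟨P, hP, hPd⟩ := ihf
    obtain ⟨Q, hQ, hQd⟩ := ihg
    refine ⟨P + Q, fun n => ?_, fun j hj => ?_⟩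
    · simp [hP, hQ, add_mul, Finset.sum_add_distrib]
    · have := natDegree_add_le (P j) (Q j)
      have h1 := hPd j hj
      have h2 := hQd j hj
      rw [Pi.add_apply]
      omega
  | smul c f _ ih =>
    obtain ⟨P, hP, hPd⟩ := ih
    refine ⟨c • P, fun n => ?_, fun j hj => ?_⟩
    · simp [hP, Finset.mul_sum, mul_assoc]
    · have := natDegree_smul_le c (P j)
      have h1 := hPd j hj
      rw [Pi.smul_apply]
      omega

end ExponentialPolynomials

/-- For each `k` there are polynomials `P_{k,0}, …, P_{k,2k} ∈ ℚ[x]` with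
`Σ_{λ ∈ Π(n)} d(λ)^k = Σ_{j=0}^{2k} P_{k,j}(n) B_{n+j}` for all `n ≥ 1`, where
`deg P_{k,2k-j} ≤ j` for `j ≤ k` and `deg P_{k,2k-j} ≤ k - ⌈(j-k)/2⌉` for `j > k`. -/
theorem dimExp_moments_shiftedBell (k : ℕ) :
    ∃ P : ℕ → Polynomial ℚ,
      (∀ n : ℕ, 1 ≤ n →
        ∑ lam : SetPartition n, (dimExp lam : ℚ) ^ k =
          ∑ j ∈ Finset.range (2 * k + 1), (P j).eval (n : ℚ) * (bell (n + j) : ℚ)) ∧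
      (∀ j : ℕ, j ≤ 2 * k →
        (j ≤ k → (P (2 * k - j)).natDegree ≤ j) ∧
        (k < j → (P (2 * k - j)).natDegree ≤ k - (j - k + 1) / 2)) := by
  obtain ⟨P, hP, hd⟩ := exists_bell_coeff_of_mem k
    (Submodule.smul_mem _ (k.factorial : ℚ) (momentPoly_mem k))
  refine ⟨P, fun n _ => ?_, fun j hj => ⟨fun h => ?_, fun h => ?_⟩⟩
  · rw [sum_dimExp_pow_eq_bellFunctional]
    simp only [bell_eq]
    rw [← hP, Pi.smul_apply, map_smul, smul_eq_mul]
  · have := hd (2 * k - j) (by omega)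
    omega
  · have := hd (2 * k - j) (by omega)
    omega
end
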